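/- For every n ≥ 1, e_{n,r}(μ)^r ≥ p_0 e_{n,r}(ν)^r + Σ_{i=1}^N p_i s_i^r e_{n,r}(μ)^r. (No separation condition on (f_i)_{i=1}^N is needed.) -/

import Mathlib

open MeasureTheory Filter

/-- The `n`-th quantization error of order `r` of a Borel measure `P` on `ℝ^q`:
the infimum of `(∫ d(x,α)^r dP)^{1/r}` over finite sets `α` with `1 ≤ card α ≤ n`. -/
noncomputable def quantErr {q : ℕ} (P : Measure (EuclideanSpace ℝ (Fin q)))
    (n : ℕ) (r : ℝ) : ℝ :=
  sInf ((fun α : Finset (EuclideanSpace ℝ (Fin q)) =>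
      (∫ x, Metric.infDist x (α : Set (EuclideanSpace ℝ (Fin q))) ^ r ∂P) ^ (1 / r)) ''
    {α : Finset (EuclideanSpace ℝ (Fin q)) | α.Nonempty ∧ α.card ≤ n})

/-- Product of weights `g` along a word `σ` (equals `1` for the empty word). -/
noncomputable def prodw {N : ℕ} (g : Fin N → ℝ) (σ : List (Fin N)) : ℝ := (σ.map g).prod

/-- The composition `f_{σ_1} ∘ ⋯ ∘ f_{σ_n}` along a word `σ`. -/
def wordMap {q N : ℕ} (f : Fin N → EuclideanSpace ℝ (Fin q) → EuclideanSpace ℝ (Fin q))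
    (σ : List (Fin N)) : EuclideanSpace ℝ (Fin q) → EuclideanSpace ℝ (Fin q) :=
  σ.foldr (fun i g => f i ∘ g) id

/-- `h(σ) = h^{(1)}(σ) + h^{(2)}(σ)` where
`h^{(1)}(σ) = Σ_{j=0}^{|σ|-1} p0 p_{σ|_j} t_{σ^{(l)}_{-j}} s_σ^r` and `h^{(2)}(σ) = p_σ s_σ^r`. -/
noncomputable def hfun {N : ℕ} (r p0 : ℝ) (s t p : Fin N → ℝ) (σ : List (Fin N)) : ℝ :=
  (∑ j ∈ Finset.range σ.length, p0 * prodw p (σ.take j) * prodw t (σ.drop j)) * prodw s σ ^ r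
    + prodw p σ * prodw s σ ^ r

/-- `η̲_r := min_{1 ≤ i ≤ N} min{p0 t_i + p_i, t_i} · s_i^r`. -/
noncomputable def etaLow {N : ℕ} (r p0 : ℝ) (s t p : Fin N → ℝ) : ℝ :=
  ⨅ i, min (p0 * t i + p i) (t i) * s i ^ r

/-- The finite maximal antichain `Λ_{k,r} = {σ : h(σ|_{|σ|-1}) ≥ η̲_r/k > h(σ)}`. -/
def Lam {N : ℕ} (r p0 : ℝ) (s t p : Fin N → ℝ) (k : ℕ) : Set (List (Fin N)) :=
  {σ | σ ≠ [] ∧ etaLow r p0 s t p / k ≤ hfun r p0 s t p σ.dropLast ∧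
    hfun r p0 s t p σ < etaLow r p0 s t p / k}

/-- `a(x) = Σ_i (t_i s_i^r)^{x/(x+r)}` (also used for `b` with `p` in place of `t`). -/
noncomputable def afun {N : ℕ} (r : ℝ) (s t : Fin N → ℝ) (x : ℝ) : ℝ :=
  ∑ i, (t i * s i ^ r) ^ (x / (x + r))

/-- A similitude of `ℝ^q` with positive ratio is surjective. -/
theorem surjective_of_dist_eq_mul {q : ℕ}
    {g : EuclideanSpace ℝ (Fin q) → EuclideanSpace ℝ (Fin q)} {c : ℝ} (hc : 0 < c)
    (hg : ∀ x y, dist (g x) (g y) = c * dist x y) : Function.Surjective g := by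
  have hiso : Isometry fun x => c⁻¹ • g x := Isometry.of_dist_eq fun x y => by
    rw [dist_smul₀, hg, norm_inv, Real.norm_of_nonneg hc.le, inv_mul_cancel_left₀ hc.ne']
  intro y
  obtain ⟨x, hx⟩ := (hiso.affineIsometryOfStrictConvexSpace.toAffineIsometryEquiv rfl).surjective
    (c⁻¹ • y)
  exact ⟨x, smul_right_injective _ (inv_ne_zero hc.ne') hx⟩

theorem infDist_image_of_dist_eq_mul {X : Type*} [PseudoMetricSpace X] {g : X → X} {c : ℝ}
    (hc : 0 < c) (hg : ∀ x y, dist (g x) (g y) = c * dist x y) (x : X) {A : Set X}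
    (hA : A.Nonempty) : Metric.infDist (g x) (g '' A) = c * Metric.infDist x A := by
  apply le_antisymm
  · rw [← div_le_iff₀' hc, Metric.le_infDist hA]
    intro y hy
    rw [div_le_iff₀' hc, ← hg]
    exact Metric.infDist_le_dist_of_mem (Set.mem_image_of_mem g hy)
  · rw [Metric.le_infDist (hA.image g)]
    rintro _ ⟨y, hy, rfl⟩
    rw [hg]
    exact mul_le_mul_of_nonneg_left (Metric.infDist_le_dist_of_mem hy) hc.le

theorem Continuous.integrable_of_compl_null {X : Type*} [TopologicalSpace X] [T2Space X]
    [MeasurableSpace X] [BorelSpace X] {P : Measure X} [IsFiniteMeasure P] {h : X → ℝ}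
    (hh : Continuous h) {K : Set X} (hK : IsCompact K) (hKP : P Kᶜ = 0) : Integrable h P := by
  have hr : P.restrict K = P := Measure.restrict_eq_self_of_ae_mem (mem_ae_iff.2 hKP)
  rw [← hr]
  exact hh.continuousOn.integrableOn_compact hK

theorem continuous_infDist_rpow {X : Type*} [PseudoMetricSpace X] (A : Set X) {r : ℝ}
    (hr : 0 ≤ r) : Continuous fun x => Metric.infDist x A ^ r :=
  (Metric.continuous_infDist_pt A).rpow_const fun _ => Or.inr hr

theorem integral_infDist_rpow_nonneg {X : Type*} [PseudoMetricSpace X] [MeasurableSpace X]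
    (P : Measure X) (A : Set X) (r : ℝ) : 0 ≤ ∫ x, Metric.infDist x A ^ r ∂P :=
  integral_nonneg fun _ => Real.rpow_nonneg Metric.infDist_nonneg r

theorem quantErr_nonneg {q : ℕ} (P : Measure (EuclideanSpace ℝ (Fin q))) (n : ℕ) (r : ℝ) :
    0 ≤ quantErr P n r := by
  apply Real.sInf_nonneg
  rintro _ ⟨α, -, rfl⟩
  exact Real.rpow_nonneg (integral_infDist_rpow_nonneg P _ r) _

theorem quantErr_rpow_le {q : ℕ} (P : Measure (EuclideanSpace ℝ (Fin q))) {n : ℕ} {r : ℝ}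
    (hr : 0 < r) {α : Finset (EuclideanSpace ℝ (Fin q))} (hα : α.Nonempty) (hn : α.card ≤ n) :
    quantErr P n r ^ r
      ≤ ∫ x, Metric.infDist x (α : Set (EuclideanSpace ℝ (Fin q))) ^ r ∂P := by
  rw [← Real.le_rpow_inv_iff_of_pos (quantErr_nonneg P n r)
    (integral_infDist_rpow_nonneg P _ r) hr, ← one_div]
  refine csInf_le ⟨0, ?_⟩ ⟨α, ⟨hα, hn⟩, rfl⟩
  rintro _ ⟨β, -, rfl⟩
  exact Real.rpow_nonneg (integral_infDist_rpow_nonneg P _ r) _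

theorem le_quantErr_rpow {q : ℕ} (P : Measure (EuclideanSpace ℝ (Fin q))) {n : ℕ} {r C : ℝ}
    (hr : 0 < r) (hn : 1 ≤ n) (hC : 0 ≤ C)
    (h : ∀ α : Finset (EuclideanSpace ℝ (Fin q)), α.Nonempty → α.card ≤ n →
      C ≤ ∫ x, Metric.infDist x (α : Set (EuclideanSpace ℝ (Fin q))) ^ r ∂P) :
    C ≤ quantErr P n r ^ r := by
  rw [← Real.rpow_inv_le_iff_of_pos hC (quantErr_nonneg P n r) hr]
  refine le_csInf ⟨_, {0}, ⟨Finset.singleton_nonempty 0, by simpa using hn⟩, rfl⟩ ?_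
  rintro _ ⟨α, ⟨hα, hαn⟩, rfl⟩
  rw [← one_div]
  exact Real.rpow_le_rpow hC (h α hα hαn) (one_div_nonneg.2 hr.le)

/-- Pulling the centres back along a similitude of ratio `c` gives
`c ^ r * e_{n,r}(P) ^ r ≤ ∫ d(g x, α) ^ r dP`. -/
theorem mul_quantErr_rpow_le_integral_comp {q : ℕ} (P : Measure (EuclideanSpace ℝ (Fin q)))
    {n : ℕ} {r : ℝ} (hr : 0 < r)
    {g : EuclideanSpace ℝ (Fin q) → EuclideanSpace ℝ (Fin q)} {c : ℝ} (hc : 0 < c)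
    (hg : ∀ x y, dist (g x) (g y) = c * dist x y)
    {α : Finset (EuclideanSpace ℝ (Fin q))} (hα : α.Nonempty) (hn : α.card ≤ n) :
    c ^ r * quantErr P n r ^ r
      ≤ ∫ x, Metric.infDist (g x) (α : Set (EuclideanSpace ℝ (Fin q))) ^ r ∂P := by
  classical
  have hsec := Function.rightInverse_surjInv (surjective_of_dist_eq_mul hc hg)
  set k := Function.surjInv (surjective_of_dist_eq_mul hc hg)
  have himage : (α : Set (EuclideanSpace ℝ (Fin q))) = g '' (α.image k : Finset _) := by
    rw [Finset.coe_image, Set.image_image]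
    simp [hsec _]
  have hint : ∀ x, Metric.infDist (g x) (α : Set (EuclideanSpace ℝ (Fin q))) ^ r
      = c ^ r * Metric.infDist x (α.image k : Finset _) ^ r := fun x => by
    rw [himage, infDist_image_of_dist_eq_mul hc hg x (Finset.coe_nonempty.2 (hα.image k)),
      Real.mul_rpow hc.le Metric.infDist_nonneg]
  simp_rw [hint]
  rw [integral_const_mul]
  exact mul_le_mul_of_nonneg_left
    (quantErr_rpow_le P hr (hα.image k) (Finset.card_image_le.trans hn)) (Real.rpow_nonneg hc.le r)

/-- Lower recursive bound for quantization errors of the in-homogeneous self-similar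
measure: `e_{n,r}(μ)^r ≥ p_0 e_{n,r}(ν)^r + Σ_i p_i s_i^r e_{n,r}(μ)^r` for all `n ≥ 1`. -/
theorem quantErr_lower_recursive_bound
    (q N : ℕ) (hq : 1 ≤ q) (hN : 2 ≤ N) (r : ℝ) (hr : 0 < r)
    (f : Fin N → EuclideanSpace ℝ (Fin q) → EuclideanSpace ℝ (Fin q))
    (s : Fin N → ℝ) (hs : ∀ i, s i ∈ Set.Ioo (0 : ℝ) 1)
    (hf : ∀ i x y, dist (f i x) (f i y) = s i * dist x y)
    (t : Fin N → ℝ) (ht : ∀ i, 0 < t i) (ht1 : ∑ i, t i = 1)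
    (ν : Measure (EuclideanSpace ℝ (Fin q))) (hνP : IsProbabilityMeasure ν)
    (hνc : ∃ K, IsCompact K ∧ ν Kᶜ = 0)
    (hνss : ν = ∑ i, ENNReal.ofReal (t i) • ν.map (f i))
    (p0 : ℝ) (p : Fin N → ℝ) (hp0 : 0 < p0) (hp : ∀ i, 0 < p i)
    (hp1 : p0 + ∑ i, p i = 1)
    (μ : Measure (EuclideanSpace ℝ (Fin q))) (hμP : IsProbabilityMeasure μ)
    (hμc : ∃ K, IsCompact K ∧ μ Kᶜ = 0)
    (hμss : μ = ENNReal.ofReal p0 • ν + ∑ i, ENNReal.ofReal (p i) • μ.map (f i))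
    :
    ∀ n : ℕ, 1 ≤ n →
      p0 * quantErr ν n r ^ r + ∑ i, p i * s i ^ r * quantErr μ n r ^ r
        ≤ quantErr μ n r ^ r := by
  intro n hn
  obtain ⟨K, hK, hKν⟩ := hνc
  obtain ⟨L, hL, hLμ⟩ := hμc
  have hcont : ∀ i, Continuous (f i) := fun i =>
    (LipschitzWith.of_dist_le_mul (K := ⟨s i, (hs i).1.le⟩) fun x y => (hf i x y).le).continuous
  refine le_quantErr_rpow μ hr hn ?_ fun α hα hαn => ?_
  · exact add_nonneg (mul_nonneg hp0.le (Real.rpow_nonneg (quantErr_nonneg _ _ _) _))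
      (Finset.sum_nonneg fun i _ => mul_nonneg
        (mul_nonneg (hp i).le (Real.rpow_nonneg (hs i).1.le _))
        (Real.rpow_nonneg (quantErr_nonneg _ _ _) _))
  have hd := continuous_infDist_rpow (α : Set (EuclideanSpace ℝ (Fin q))) hr.le
  have hmap : ∀ i, Integrable (fun x => Metric.infDist x (α : Set _) ^ r) (μ.map (f i)) :=
    fun i => (integrable_map_measure hd.aestronglyMeasurable (hcont i).aemeasurable).2
      ((hd.comp (hcont i)).integrable_of_compl_null hL hLμ)
  have hsmul : ∀ i ∈ Finset.univ, Integrable (fun x => Metric.infDist x (α : Set _) ^ r)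
      (ENNReal.ofReal (p i) • μ.map (f i)) :=
    fun i _ => (hmap i).smul_measure ENNReal.ofReal_ne_top
  have key : ∫ x, Metric.infDist x (α : Set _) ^ r ∂μ
      = p0 * ∫ x, Metric.infDist x (α : Set _) ^ r ∂ν
        + ∑ i, p i * ∫ x, Metric.infDist (f i x) (α : Set _) ^ r ∂μ := by
    conv_lhs => rw [hμss]
    rw [integral_add_measure
      ((hd.integrable_of_compl_null hK hKν).smul_measure ENNReal.ofReal_ne_top)
      (integrable_finsetSum_measure.2 hsmul), integral_finsetSum_measure hsmul,
      integral_smul_measure, ENNReal.toReal_ofReal hp0.le, smul_eq_mul]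
    congr 1
    refine Finset.sum_congr rfl fun i _ => ?_
    rw [integral_smul_measure, ENNReal.toReal_ofReal (hp i).le, smul_eq_mul,
      integral_map (hcont i).aemeasurable hd.aestronglyMeasurable]
  rw [key]
  refine add_le_add (mul_le_mul_of_nonneg_left (quantErr_rpow_le ν hr hα hαn) hp0.le)
    (Finset.sum_le_sum fun i _ => ?_)
  rw [mul_assoc]
  exact mul_le_mul_of_nonneg_left
    (mul_quantErr_rpow_le_integral_comp μ hr (hs i).1 (hf i) hα hαn) (hp i).le
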